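/- Let u be a real number. A point (x, y) ∈ ℝ² satisfies both (x − cos u)² + (y − sin u)² − cos² u = 0 and x·sin u − y·cos u + sin u·cos u = 0 if and only if (x, y) = (0, sin u) or (x, y) = (2·cos³ u, 3·sin u − 2·sin³ u). -/

import Mathlib

open Real

/-- For the family of circles `F(x,y,u) = (x - cos u)^2 + (y - sin u)^2 - cos^2 u = 0`,
a point `(x, y)` satisfies `F(x,y,u) = 0` together with
`x*sin u - y*cos u + sin u * cos u = 0` if and only if `(x, y) = (0, sin u)` or
`(x, y) = (2*cos^3 u, 3*sin u - 2*sin^3 u)`. -/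
theorem stmt_6 (u x y : ℝ) :
    ((x - cos u) ^ 2 + (y - sin u) ^ 2 - (cos u) ^ 2 = 0 ∧
        x * sin u - y * cos u + sin u * cos u = 0) ↔
      ((x, y) = (0, sin u) ∨ (x, y) = (2 * (cos u) ^ 3, 3 * sin u - 2 * (sin u) ^ 3)) := by
  have h := sin_sq_add_cos_sq u
  simp only [Prod.mk.injEq]
  generalize sin u = s at *
  generalize cos u = c at *
  constructor
  · rintro ⟨h₁, h₂⟩
    have hx : x * (x - 2 * c ^ 3) = 0 := by
      linear_combination c ^ 2 * h₁ + (x * s + (y - s) * c) * h₂ - x ^ 2 * h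
    rcases mul_eq_zero.mp hx with rfl | hx
    · have hy : (y - s) ^ 2 = 0 := by linear_combination h₁
      exact Or.inl ⟨rfl, sub_eq_zero.mp (pow_eq_zero_iff two_ne_zero |>.mp hy)⟩
    · obtain rfl : x = 2 * c ^ 3 := sub_eq_zero.mp hx
      have hy : (y - s - 2 * c ^ 2 * s) ^ 2 = 0 := by
        linear_combination h₁ + 4 * c * s * h₂ - 4 * c ^ 4 * h
      have hy' := pow_eq_zero_iff two_ne_zero |>.mp hy
      exact Or.inr ⟨rfl, by linear_combination hy' + 2 * s * h⟩
  · rintro (⟨rfl, rfl⟩ | ⟨rfl, rfl⟩)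
    · constructor <;> ring
    · have hy : 3 * s - 2 * s ^ 3 = s + 2 * c ^ 2 * s := by linear_combination -2 * s * h
      rw [hy]
      constructor
      · linear_combination 4 * c ^ 4 * h
      · ring
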